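/- (Theorem 3, sandpile interpretation) Let G be the path on the ordered variable set V = {x_0, x_1, ..., x_n} with edges (x_i, x_{i+1}), 0 ≤ i ≤ n−1, let Φ = DS_G, and set y_i = x_0 + ... + x_i. Let P be any real-valued function on the set of (n+1)-tuples (c_0, ..., c_n) of nonnegative integers with Σ c_i = n (indices modulo n+1) satisfying: (i) P(1, 1, ..., 1, 0) = 1; (ii) P(c_0, ..., c_n) = 0 whenever c_n > 0; and (iii) for every tuple c and every index k with c_k ≥ 2, 2·P(c) = P(c with c_{k−1} increased by 1, c_k decreased by 1) + P(c with c_k decreased by 1, c_{k+1} increased by 1). Then P(c_0, ..., c_n) = Φ(Π_{i=0}^{n} y_i^{c_i}) / n! for all such tuples. -/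

import Mathlib

open MvPolynomial

/-- Partial divided symmetrization of a polynomial `f` over the graph on the variables
`x_0 < x_1 < ... < x_{m-1}` whose (ordered) edges form the finset `E`:
`DS_G(f) = Σ_π (f ∘ π) / Π_{(x,y) ∈ E} (x_π − y_π)`,
the sum being over all `m!` permutations of the variables. -/
noncomputable def DS {K : Type*} [Field K] {m : ℕ} (E : Finset (Fin m × Fin m))
    (f : MvPolynomial (Fin m) K) : FractionRing (MvPolynomial (Fin m) K) :=
  ∑ π : Equiv.Perm (Fin m),
    algebraMap (MvPolynomial (Fin m) K) (FractionRing (MvPolynomial (Fin m) K))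
        (rename (⇑π) f) /
      algebraMap (MvPolynomial (Fin m) K) (FractionRing (MvPolynomial (Fin m) K))
        (rename (⇑π) (∏ e ∈ E, (X e.1 - X e.2)))

/-- The edge set of the path `x_0 — x_1 — ⋯ — x_n`: the pairs `(x_i, x_{i+1})`,
`0 ≤ i ≤ n−1`. -/
def pathEdges (n : ℕ) : Finset (Fin (n + 1) × Fin (n + 1)) :=
  Finset.univ.image fun i : Fin n => (i.castSucc, i.succ)

/-- `pathY n K k = y_k = x_0 + x_1 + ⋯ + x_k`. -/
noncomputable def pathY (n : ℕ) (K : Type*) [Field K] (k : Fin (n + 1)) :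
    MvPolynomial (Fin (n + 1)) K :=
  ∑ j ∈ Finset.Iic k, X j

theorem Finset.sum_range_card_le_sum_id (s : Finset ℕ) :
    ∑ i ∈ Finset.range s.card, i ≤ ∑ i ∈ s, i := by
  induction s using Finset.induction_on_max with
  | empty => simp
  | insert a s ha ih =>
    have has : a ∉ s := fun h => lt_irrefl a (ha a h)
    have hcard : s.card ≤ a := by
      simpa using Finset.card_le_card (fun x hx => Finset.mem_range.2 (ha x hx) :
        s ⊆ Finset.range a)
    rw [Finset.card_insert_of_notMem has, Finset.sum_range_succ, Finset.sum_insert has]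
    omega

theorem Fin.sum_val_le_sum_of_injective {m : ℕ} {e : Fin m → ℕ} (he : Function.Injective e) :
    ∑ j : Fin m, (j : ℕ) ≤ ∑ j, e j := by
  have h := Finset.sum_range_card_le_sum_id (Finset.univ.image e)
  rwa [Finset.card_image_of_injective _ he, Finset.card_univ, Fintype.card_fin,
    Finset.sum_image he.injOn, ← Fin.sum_univ_eq_sum_range] at h

section

variable {F : Type*} [Field F]

theorem sum_sign_mul_prod_pow_eq_zero {m : ℕ} (z : Fin m → F) (e : Fin m → ℕ)
    (he : ∑ j, e j < ∑ j : Fin m, (j : ℕ)) :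
    ∑ σ : Equiv.Perm (Fin m), ((Equiv.Perm.sign σ : ℤ) : F) * ∏ j, z (σ j) ^ e j = 0 := by
  have hinj : ¬ Function.Injective e := fun h => absurd (Fin.sum_val_le_sum_of_injective h) he.not_ge
  obtain ⟨i, j, hij, hne⟩ := by simpa [Function.Injective] using hinj
  have h := Matrix.det_zero_of_column_eq (M := Matrix.of fun a b => z a ^ e b) hne
    (fun k => by simp [hij])
  rwa [Matrix.det_apply'] at h

theorem sum_sign_mul_eval_eq_zero {m : ℕ} (z : Fin m → F) (q : MvPolynomial (Fin m) F)
    (hq : q.totalDegree < ∑ j : Fin m, (j : ℕ)) :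
    ∑ σ : Equiv.Perm (Fin m), ((Equiv.Perm.sign σ : ℤ) : F) * eval (z ∘ σ) q = 0 := by
  simp_rw [eval_eq', Finset.mul_sum]
  rw [Finset.sum_comm]
  refine Finset.sum_eq_zero fun d hd => ?_
  have hdeg : ∑ j, d j < ∑ j : Fin m, (j : ℕ) := by
    refine lt_of_le_of_lt ?_ hq
    simpa [Finsupp.sum_fintype] using le_totalDegree hd
  rw [← mul_zero (coeff d q), ← sum_sign_mul_prod_pow_eq_zero z d hdeg, Finset.mul_sum]
  exact Finset.sum_congr rfl fun σ _ => by simp only [Function.comp]; ring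

/-- The product of the differences along the edges of a path. -/
def pathDiff {R : Type*} [CommRing R] {l : ℕ} (z : Fin (l + 1) → R) : R :=
  ∏ i : Fin l, (z i.castSucc - z i.succ)

theorem Fin.prod_prod_Iio_eq {R : Type*} [CommRing R] {l : ℕ} (z : Fin (l + 1) → R) :
    ∏ j, ∏ i ∈ Finset.Iio j, (z i - z j) =
      pathDiff z * ∏ k : Fin l, ∏ i ∈ Finset.Iio k.castSucc, (z i - z k.succ) := by
  rw [Fin.prod_univ_succ, pathDiff, ← Finset.prod_mul_distrib]
  have h0 : Finset.Iio (0 : Fin (l + 1)) = ∅ := by ext; simp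
  rw [h0, Finset.prod_empty, one_mul]
  refine Finset.prod_congr rfl fun k _ => ?_
  have hk : Finset.Iio k.succ = insert k.castSucc (Finset.Iio k.castSucc) := by
    ext i
    simp only [Finset.mem_Iio, Finset.mem_insert, Fin.lt_def, Fin.ext_iff, Fin.val_succ,
      Fin.val_castSucc]
    omega
  rw [hk, Finset.prod_insert (by simp)]

theorem pathDiff_ne_zero {l : ℕ} {z : Fin (l + 1) → F} (hz : Function.Injective z) :
    pathDiff z ≠ 0 :=
  Finset.prod_ne_zero_iff.2 fun _ _ => sub_ne_zero.2 (hz.ne Fin.castSucc_lt_succ.ne)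

/-- The divided symmetrization along the path, evaluated at the points `z`. -/
noncomputable def pathSym {l : ℕ} (z : Fin (l + 1) → F) (p : MvPolynomial (Fin (l + 1)) F) : F :=
  ∑ σ : Equiv.Perm (Fin (l + 1)), eval (z ∘ σ) p / pathDiff (z ∘ σ)

theorem pathSym_eq_zero_of_totalDegree_lt {l : ℕ} {z : Fin (l + 1) → F}
    (hz : Function.Injective z) (p : MvPolynomial (Fin (l + 1)) F) (hp : p.totalDegree < l) :
    pathSym z p = 0 := by
  set V : F := ∏ j, ∏ i ∈ Finset.Iio j, (z i - z j) with hV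
  have hV0 : V ≠ 0 := Finset.prod_ne_zero_iff.2 fun j _ => Finset.prod_ne_zero_iff.2 fun i hi =>
    sub_ne_zero.2 (hz.ne (Finset.mem_Iio.1 hi).ne)
  set W : MvPolynomial (Fin (l + 1)) F :=
    ∏ k : Fin l, ∏ i ∈ Finset.Iio k.castSucc, (X i - X k.succ) with hW
  have hWdeg : W.totalDegree ≤ ∑ k : Fin l, (k : ℕ) := by
    refine (totalDegree_finsetProd _ _).trans (Finset.sum_le_sum fun k _ => ?_)
    refine (totalDegree_finsetProd _ _).trans ?_
    refine (Finset.sum_le_card_nsmul _ _ 1 fun i _ => ?_).trans (by simp)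
    exact (totalDegree_sub _ _).trans (by simp)
  have hdeg : (p * W).totalDegree < ∑ j : Fin (l + 1), (j : ℕ) := by
    refine (totalDegree_mul _ _).trans_lt ?_
    rw [Fin.sum_univ_succ]
    simp only [Fin.val_zero, Fin.val_succ, Finset.sum_add_distrib]
    simp
    omega
  refine (mul_eq_zero.1 (?_ : V * pathSym z p = 0)).resolve_left hV0
  rw [← sum_sign_mul_eval_eq_zero z (p * W) hdeg, pathSym, Finset.mul_sum]
  refine Finset.sum_congr rfl fun σ _ => ?_
  have hsign := σ.prod_Iio_comp_eq_sign_mul_prod (f := fun i j => z i - z j) (by simp)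
  have hfac := Fin.prod_prod_Iio_eq (z ∘ σ)
  simp only [Function.comp_apply] at hfac
  rw [hfac, ← hV] at hsign
  have hWe : eval (z ∘ σ) W =
      ∏ k : Fin l, ∏ i ∈ Finset.Iio k.castSucc, (z (σ i) - z (σ k.succ)) := by
    simp [hW, map_prod]
  rw [← hWe] at hsign
  have hD := pathDiff_ne_zero (hz.comp σ.injective)
  have hsq : ((Equiv.Perm.sign σ : ℤ) : F) * ((Equiv.Perm.sign σ : ℤ) : F) = 1 := by
    rw [← Int.cast_mul, ← Units.val_mul, Int.units_mul_self]; simp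
  have hVeq : V = ((Equiv.Perm.sign σ : ℤ) : F) * (pathDiff (z ∘ σ) * eval (z ∘ σ) W) := by
    rw [hsign, ← mul_assoc, hsq, one_mul]
  rw [map_mul, hVeq]
  field_simp

theorem card_mul_sum_perm {α β : Type*} [Fintype α] [DecidableEq α] [Fintype β] [DecidableEq β]
    (ι : α ↪ β) (G : Equiv.Perm β → F) :
    (Fintype.card (Equiv.Perm α) : F) * ∑ π, G π =
      ∑ π, ∑ σ : Equiv.Perm α, G (π * σ.viaEmbedding ι) := by
  rw [Finset.sum_comm, ← nsmul_eq_mul, ← Finset.card_univ, ← Finset.sum_const]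
  exact Finset.sum_congr rfl fun σ _ =>
    (Equiv.sum_comp (Equiv.mulRight (σ.viaEmbedding ι)) G).symm

theorem sum_mul_block_eq_zero [CharZero F] {β : Type*} [Fintype β] [DecidableEq β] {l : ℕ}
    (ι : Fin (l + 1) ↪ β) {x : β → F} (hx : Function.Injective x) (G : Equiv.Perm β → F)
    (hG : ∀ π (σ : Equiv.Perm (Fin (l + 1))), G (π * σ.viaEmbedding ι) = G π)
    (p : MvPolynomial (Fin (l + 1)) F) (hp : p.totalDegree < l) :
    ∑ π : Equiv.Perm β, G π * (eval (x ∘ π ∘ ι) p / pathDiff (x ∘ π ∘ ι)) = 0 := by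
  have hcard : (Fintype.card (Equiv.Perm (Fin (l + 1))) : F) ≠ 0 :=
    Nat.cast_ne_zero.2 Fintype.card_ne_zero
  refine (mul_eq_zero.1 ?_).resolve_left hcard
  rw [card_mul_sum_perm ι]
  refine Finset.sum_eq_zero fun π _ => ?_
  have h := pathSym_eq_zero_of_totalDegree_lt (hx.comp (π.injective.comp ι.injective)) p hp
  rw [← mul_zero (G π), ← h, pathSym, Finset.mul_sum]
  refine Finset.sum_congr rfl fun σ _ => ?_
  have hc : x ∘ (π * σ.viaEmbedding ι) ∘ ι = (x ∘ π ∘ ι) ∘ σ := by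
    funext j
    simp [Equiv.Perm.viaEmbedding_apply]
  rw [hG, hc]

theorem totalDegree_prod_X_pow_le {m : ℕ} (e : Fin m → ℕ) :
    (∏ j, (X j : MvPolynomial (Fin m) F) ^ e j).totalDegree ≤ ∑ j, e j :=
  (totalDegree_finsetProd _ _).trans (Finset.sum_le_sum fun j _ =>
    (totalDegree_pow _ _).trans (by simp))

theorem pathDiff_split {a b : ℕ} (z : Fin (a + 1 + b + 1) → F) :
    pathDiff z = pathDiff (l := a) (z ∘ Fin.castAddEmb (b + 1)) *
      (z ⟨a, by omega⟩ - z ⟨a + 1, by omega⟩) *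
      pathDiff (l := b) (z ∘ Fin.natAddEmb (m := b + 1) (a + 1)) := by
  simp only [pathDiff]
  rw [Fin.prod_univ_add, Fin.prod_univ_castSucc]
  rfl

theorem eval_pathY {n : ℕ} (z : Fin (n + 1) → F) (k : Fin (n + 1)) :
    eval z (pathY n F k) = ∑ j ∈ Finset.Iic k, z j := by
  simp [pathY]

theorem sum_Iic_eq_sum_castAdd {a b : ℕ} (z : Fin (a + 1 + b + 1) → F) :
    ∑ j ∈ Finset.Iic (⟨a, by omega⟩ : Fin (a + 1 + b + 1)), z j =
      ∑ j : Fin (a + 1), z (Fin.castAddEmb (b + 1) j) := by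
  have h : Finset.Iic (⟨a, by omega⟩ : Fin (a + 1 + b + 1)) =
      Finset.univ.map (Fin.castAddEmb (n := a + 1) (b + 1)) := by
    ext j
    simp only [Finset.mem_Iic, Fin.le_def, Finset.mem_map, Finset.mem_univ, true_and]
    constructor
    · intro hj
      exact ⟨⟨j, by omega⟩, rfl⟩
    · rintro ⟨i, rfl⟩
      simp
      omega
  rw [h, Finset.sum_map]

theorem sum_block_monomial_eq_zero [CharZero F] {a b : ℕ} {x : Fin (a + 1 + b + 1) → F}
    (hx : Function.Injective x) (e : Fin (a + 1 + b + 1) → ℕ) (he : ∑ j, e j < a + b) :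
    ∑ π : Equiv.Perm (Fin (a + 1 + b + 1)),
      (∑ j : Fin (a + 1), x (π (Fin.castAddEmb (b + 1) j))) * (∏ j, x (π j) ^ e j) *
        (x (π ⟨a, by omega⟩) - x (π ⟨a + 1, by omega⟩)) / pathDiff (x ∘ π) = 0 := by
  set ι₁ : Fin (a + 1) ↪ Fin (a + 1 + b + 1) := Fin.castAddEmb (b + 1) with hι₁
  set ι₂ : Fin (b + 1) ↪ Fin (a + 1 + b + 1) := Fin.natAddEmb (a + 1) with hι₂
  have hne : ∀ i j, ι₁ i ≠ ι₂ j := fun i j h => by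
    have := congrArg Fin.val h
    simp [hι₁, hι₂] at this
    omega
  have h12 : ∀ (σ : Equiv.Perm (Fin (a + 1))) j, σ.viaEmbedding ι₁ (ι₂ j) = ι₂ j := fun σ j =>
    Equiv.Perm.viaEmbedding_apply_of_notMem _ _ _ (by rintro ⟨i, hi⟩; exact hne _ _ hi)
  have h21 : ∀ (σ : Equiv.Perm (Fin (b + 1))) j, σ.viaEmbedding ι₂ (ι₁ j) = ι₁ j := fun σ j =>
    Equiv.Perm.viaEmbedding_apply_of_notMem _ _ _ (by rintro ⟨i, hi⟩; exact hne _ _ hi.symm)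
  set p₁ : MvPolynomial (Fin (a + 1)) F := ∏ j, X j ^ e (ι₁ j) with hp₁
  set p₂ : MvPolynomial (Fin (b + 1)) F := ∏ j, X j ^ e (ι₂ j) with hp₂
  have hsum : ∑ j, e j = ∑ j, e (ι₁ j) + ∑ j, e (ι₂ j) := Fin.sum_univ_add (a := a + 1) (b := b + 1) e
  have hd₁ : p₁.totalDegree ≤ _ := totalDegree_prod_X_pow_le _
  have hd₂ : p₂.totalDegree ≤ _ := totalDegree_prod_X_pow_le _
  set Y : Equiv.Perm (Fin (a + 1 + b + 1)) → F := fun π => ∑ j, x (π (ι₁ j)) with hY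
  have hterm : ∀ π : Equiv.Perm (Fin (a + 1 + b + 1)),
      (∑ j, x (π (ι₁ j))) * (∏ j, x (π j) ^ e j) *
        (x (π ⟨a, by omega⟩) - x (π ⟨a + 1, by omega⟩)) / pathDiff (x ∘ π) =
      Y π * (eval (x ∘ π ∘ ι₁) p₁ / pathDiff (x ∘ π ∘ ι₁)) *
        (eval (x ∘ π ∘ ι₂) p₂ / pathDiff (x ∘ π ∘ ι₂)) := by
    intro π
    have h1 := pathDiff_ne_zero (hx.comp (π.injective.comp ι₁.injective))
    have h2 := pathDiff_ne_zero (hx.comp (π.injective.comp ι₂.injective))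
    have h3 : x (π ⟨a, by omega⟩) - x (π ⟨a + 1, by omega⟩) ≠ 0 :=
      sub_ne_zero.2 ((hx.comp π.injective).ne (by simp))
    have hprod : ∏ j, x (π j) ^ e j = eval (x ∘ π ∘ ι₁) p₁ * eval (x ∘ π ∘ ι₂) p₂ := by
      simp only [hp₁, hp₂, map_prod, map_pow, eval_X]
      exact Fin.prod_univ_add (a := a + 1) (b := b + 1) _
    rw [pathDiff_split, hprod]
    simp only [Function.comp_def] at h1 h2 h3 ⊢
    simp only [hY, ← hι₁, ← hι₂]
    field_simp
  rw [Finset.sum_congr rfl fun π _ => hterm π]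
  rcases lt_or_ge (∑ j, e (ι₁ j)) a with hlt | hge
  · rw [← sum_mul_block_eq_zero ι₁ hx
      (fun π => Y π * (eval (x ∘ π ∘ ι₂) p₂ / pathDiff (x ∘ π ∘ ι₂))) ?_ p₁ (hd₁.trans_lt hlt)]
    · exact Finset.sum_congr rfl fun π _ => by ring
    · intro π σ
      have hc : x ∘ (π * σ.viaEmbedding ι₁) ∘ ι₂ = x ∘ π ∘ ι₂ := by
        funext j
        simp [h12]
      have hYσ : Y (π * σ.viaEmbedding ι₁) = Y π := by
        simp only [hY, Equiv.Perm.mul_apply, Equiv.Perm.viaEmbedding_apply]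
        exact Equiv.sum_comp σ fun j => x (π (ι₁ j))
      simp only [hc, hYσ]
  · refine sum_mul_block_eq_zero ι₂ hx
      (fun π => Y π * (eval (x ∘ π ∘ ι₁) p₁ / pathDiff (x ∘ π ∘ ι₁))) ?_ p₂
      (hd₂.trans_lt (by omega))
    intro π σ
    have hc : x ∘ (π * σ.viaEmbedding ι₂) ∘ ι₁ = x ∘ π ∘ ι₁ := by
      funext j
      simp [h21]
    have hYσ : Y (π * σ.viaEmbedding ι₂) = Y π := by
      simp only [hY, Equiv.Perm.mul_apply, h21]
    simp only [hc, hYσ]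

theorem pathSym_pathY_mul_sub_eq_zero [CharZero F] {n : ℕ} {x : Fin (n + 1) → F}
    (hx : Function.Injective x) (i : Fin n) (h : MvPolynomial (Fin (n + 1)) F)
    (hh : h.totalDegree + 1 < n) :
    pathSym x (pathY n F i.castSucc * h * (X i.castSucc - X i.succ)) = 0 := by
  obtain ⟨a, ha⟩ := i
  obtain ⟨b, rfl⟩ : ∃ b, n = a + 1 + b := Nat.exists_eq_add_of_le ha
  have hcalc : ∀ π : Equiv.Perm (Fin (a + 1 + b + 1)),
      eval (x ∘ π) (pathY (a + 1 + b) F (Fin.castSucc ⟨a, ha⟩) * h *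
        (X (Fin.castSucc ⟨a, ha⟩) - X (Fin.succ ⟨a, ha⟩))) / pathDiff (x ∘ π) =
      ∑ d ∈ h.support, coeff d h * ((∑ j : Fin (a + 1), x (π (Fin.castAddEmb (b + 1) j))) *
        (∏ j, x (π j) ^ d j) *
        (x (π ⟨a, by omega⟩) - x (π ⟨a + 1, by omega⟩)) / pathDiff (x ∘ π)) := by
    intro π
    rw [map_mul, map_mul, eval_pathY, Fin.castSucc_mk, Fin.succ_mk, sum_Iic_eq_sum_castAdd,
      eval_eq', map_sub, eval_X, eval_X, Finset.mul_sum, Finset.sum_mul, Finset.sum_div]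
    refine Finset.sum_congr rfl fun d _ => ?_
    simp only [Function.comp_apply]
    ring
  rw [pathSym, Finset.sum_congr rfl fun π _ => hcalc π, Finset.sum_comm]
  refine Finset.sum_eq_zero fun d hd => ?_
  have hdeg : ∑ j, d j ≤ h.totalDegree := by
    simpa [Finsupp.sum_fintype] using le_totalDegree hd
  rw [← Finset.mul_sum, sum_block_monomial_eq_zero hx d (by omega), mul_zero]

theorem pathSym_pathY_last_mul_eq_zero {n : ℕ} {x : Fin (n + 1) → F}
    (hx : Function.Injective x) (h : MvPolynomial (Fin (n + 1)) F) (hh : h.totalDegree < n) :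
    pathSym x (pathY n F (Fin.last n) * h) = 0 := by
  rw [← mul_zero (∑ j, x j), ← pathSym_eq_zero_of_totalDegree_lt hx h hh, pathSym, pathSym,
    Finset.mul_sum]
  refine Finset.sum_congr rfl fun σ _ => ?_
  have hs : ∑ j ∈ Finset.Iic (Fin.last n), (x ∘ σ) j = ∑ j, x j := by
    rw [← Fin.top_eq_last, Finset.Iic_top]
    exact Equiv.sum_comp σ x
  rw [map_mul, eval_pathY, hs, mul_div_assoc]

theorem pathSym_add {l : ℕ} (z : Fin (l + 1) → F) (p q : MvPolynomial (Fin (l + 1)) F) :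
    pathSym z (p + q) = pathSym z p + pathSym z q := by
  simp only [pathSym, map_add, add_div, Finset.sum_add_distrib]

theorem pathSym_C_mul {l : ℕ} (z : Fin (l + 1) → F) (c : F) (p : MvPolynomial (Fin (l + 1)) F) :
    pathSym z (C c * p) = c * pathSym z p := by
  simp only [pathSym, map_mul, eval_C, mul_div_assoc, Finset.mul_sum]

theorem pathSym_sum {l : ℕ} {ι : Type*} (z : Fin (l + 1) → F) (s : Finset ι)
    (p : ι → MvPolynomial (Fin (l + 1)) F) :
    pathSym z (∑ i ∈ s, p i) = ∑ i ∈ s, pathSym z (p i) := by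
  simp only [pathSym, map_sum, Finset.sum_div]
  exact Finset.sum_comm

theorem totalDegree_pathY_le {n : ℕ} (k : Fin (n + 1)) : (pathY n F k).totalDegree ≤ 1 :=
  totalDegree_finsetSum_le fun j _ => by simp

theorem pathY_succ {n : ℕ} (i : Fin n) :
    pathY n F i.succ = pathY n F i.castSucc + X i.succ := by
  have h : Finset.Iic i.succ = insert i.succ (Finset.Iic i.castSucc) := by
    ext j
    simp only [Finset.mem_Iic, Finset.mem_insert, Fin.le_def, Fin.ext_iff, Fin.val_succ,
      Fin.val_castSucc]
    omega
  rw [pathY, h, Finset.sum_insert (by simp)]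
  exact add_comm _ _

theorem pathY_zero {n : ℕ} : pathY n F 0 = X 0 := by
  have h : Finset.Iic (0 : Fin (n + 1)) = {0} := by
    ext j
    simp
  rw [pathY, h, Finset.sum_singleton]

theorem pathY_last {n : ℕ} : pathY n F (Fin.last n) = ∑ j, X j := by
  rw [pathY, ← Fin.top_eq_last, Finset.Iic_top]

theorem sum_succ_mul_sub {R : Type*} [CommRing R] {n : ℕ} (z : Fin (n + 1) → R) :
    ∑ i : Fin n, ((i : ℕ) + 1 : R) * (z i.castSucc - z i.succ) =
      ∑ j, z j - (n + 1 : R) * z (Fin.last n) := by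
  induction n with
  | zero => simp
  | succ n ih =>
    rw [Fin.sum_univ_castSucc, Fin.sum_univ_castSucc (n := n + 1)]
    have h := ih fun j => z j.castSucc
    simp only [Fin.val_castSucc, Fin.succ_castSucc, Fin.val_last, Fin.succ_last] at h ⊢
    rw [h]
    push_cast
    ring

theorem eval_pathY_castSucc {n : ℕ} (z : Fin (n + 2) → F) (k : Fin (n + 1)) :
    eval z (pathY (n + 1) F k.castSucc) = eval (z ∘ Fin.castSucc) (pathY n F k) := by
  have h : Finset.Iic k.castSucc = (Finset.Iic k).map Fin.castSuccEmb := by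
    simp
  rw [eval_pathY, eval_pathY, h, Finset.sum_map]
  rfl

theorem pathSym_mul_last_sub {n : ℕ} [CharZero F] {x : Fin (n + 2) → F}
    (hx : Function.Injective x) (p : MvPolynomial (Fin (n + 2)) F)
    (q : MvPolynomial (Fin (n + 1)) F) (c : F)
    (hpq : ∀ z : Fin (n + 2) → F, eval z p = eval (z ∘ Fin.castSucc) q)
    (hq : ∀ z : Fin (n + 1) → F, Function.Injective z → pathSym z q = c) :
    pathSym x (p * (X (Fin.last n).castSucc - X (Fin.last n).succ)) = (n + 2) * c := by
  have hcard : (Fintype.card (Equiv.Perm (Fin (n + 1))) : F) ≠ 0 :=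
    Nat.cast_ne_zero.2 Fintype.card_ne_zero
  have hterm : ∀ π : Equiv.Perm (Fin (n + 2)),
      eval (x ∘ π) (p * (X (Fin.last n).castSucc - X (Fin.last n).succ)) / pathDiff (x ∘ π) =
      eval (x ∘ π ∘ Fin.castSucc) q / pathDiff (x ∘ π ∘ Fin.castSucc) := by
    intro π
    have h3 : x (π (Fin.last n).castSucc) - x (π (Fin.last n).succ) ≠ 0 :=
      sub_ne_zero.2 ((hx.comp π.injective).ne Fin.castSucc_lt_succ.ne)
    have hD : pathDiff (x ∘ π) = pathDiff (x ∘ π ∘ Fin.castSucc) *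
        (x (π (Fin.last n).castSucc) - x (π (Fin.last n).succ)) := by
      simp only [pathDiff]
      rw [Fin.prod_univ_castSucc]
      rfl
    rw [hD, map_mul, hpq, map_sub, eval_X, eval_X]
    exact mul_div_mul_right _ _ h3
  apply mul_left_cancel₀ hcard
  rw [pathSym, Finset.sum_congr rfl fun π _ => hterm π, card_mul_sum_perm Fin.castSuccEmb]
  have hinner : ∀ π : Equiv.Perm (Fin (n + 2)),
      ∑ σ : Equiv.Perm (Fin (n + 1)),
        eval (x ∘ (π * σ.viaEmbedding Fin.castSuccEmb) ∘ Fin.castSucc) q /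
          pathDiff (x ∘ (π * σ.viaEmbedding Fin.castSuccEmb) ∘ Fin.castSucc) = c := by
    intro π
    rw [← hq (x ∘ π ∘ Fin.castSucc)
      (hx.comp (π.injective.comp (Fin.castSucc_injective _))), pathSym]
    refine Finset.sum_congr rfl fun σ _ => ?_
    have hc : x ∘ (π * σ.viaEmbedding Fin.castSuccEmb) ∘ Fin.castSucc =
        (x ∘ π ∘ Fin.castSucc) ∘ σ := by
      funext j
      have := Equiv.Perm.viaEmbedding_apply σ Fin.castSuccEmb j
      simp only [Fin.coe_castSuccEmb] at this
      simp [this]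
    rw [hc]
  rw [Finset.sum_congr rfl fun π _ => hinner π, Finset.sum_const, Finset.card_univ, nsmul_eq_mul,
    Fintype.card_perm, Fintype.card_perm, Fintype.card_fin, Fintype.card_fin,
    Nat.factorial_succ (n + 1)]
  push_cast
  ring

theorem pathSym_prod_pathY [CharZero F] {n : ℕ} {x : Fin (n + 1) → F}
    (hx : Function.Injective x) :
    pathSym x (∏ k : Fin n, pathY n F k.castSucc) = n.factorial := by
  induction n with
  | zero => simp [pathSym, pathDiff]
  | succ m ih =>
    rw [Fin.prod_univ_castSucc]
    set h : MvPolynomial (Fin (m + 2)) F :=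
      ∏ k : Fin m, pathY (m + 1) F k.castSucc.castSucc with hh
    have hdeg : ∀ s : Finset (Fin m),
        (∏ k ∈ s, pathY (m + 1) F k.castSucc.castSucc).totalDegree ≤ s.card := fun s =>
      (totalDegree_finsetProd _ _).trans
        ((Finset.sum_le_card_nsmul _ _ 1 fun i _ => totalDegree_pathY_le _).trans (by simp))
    have hlast := pathY_succ (F := F) (Fin.last m)
    have hsum := sum_succ_mul_sub (fun j => (X j : MvPolynomial (Fin (m + 2)) F))
    rw [← pathY_last] at hsum
    have key : C ((m : F) + 2) * (h * pathY (m + 1) F (Fin.last m).castSucc) =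
        C ((m : F) + 1) * (pathY (m + 1) F (Fin.last (m + 1)) * h) +
        ∑ i : Fin (m + 1), C (((i : ℕ) : F) + 1) * (h * (X i.castSucc - X i.succ)) := by
      have hr : ∑ i : Fin (m + 1), C (((i : ℕ) : F) + 1) * (h * (X i.castSucc - X i.succ)) =
          h * ∑ i : Fin (m + 1), (((i : ℕ) : MvPolynomial (Fin (m + 2)) F) + 1) *
            (X i.castSucc - X i.succ) := by
        rw [Finset.mul_sum]
        refine Finset.sum_congr rfl fun i _ => ?_
        simp only [map_add, map_natCast, map_one]
        ring
      rw [hr, hsum]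
      simp only [Fin.succ_last] at hlast
      rw [hlast]
      simp only [map_add, map_natCast, map_one, map_ofNat]
      push_cast
      ring
    have hzero : ∀ i : Fin m, pathSym x (h * (X i.castSucc.castSucc - X i.castSucc.succ)) = 0 := by
      intro i
      rw [hh, ← Finset.mul_prod_erase _ _ (Finset.mem_univ i)]
      refine pathSym_pathY_mul_sub_eq_zero hx i.castSucc _ ?_
      have := hdeg (Finset.univ.erase i)
      rw [Finset.card_erase_of_mem (Finset.mem_univ i), Finset.card_univ, Fintype.card_fin] at this
      have := i.pos
      omega
    have htop : pathSym x (h * (X (Fin.last m).castSucc - X (Fin.last m).succ)) =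
        (m + 2) * m.factorial :=
      pathSym_mul_last_sub hx h (∏ k : Fin m, pathY m F k.castSucc) _
        (fun z => by simp only [hh, map_prod, eval_pathY_castSucc]) fun z hz => ih hz
    have hsym := congrArg (pathSym x) key
    rw [pathSym_C_mul, pathSym_add, pathSym_C_mul, pathSym_sum,
      pathSym_pathY_last_mul_eq_zero hx h
        (by have : h.totalDegree ≤ _ := hdeg Finset.univ; simp at this; omega), mul_zero, zero_add,
      Fin.sum_univ_castSucc] at hsym
    simp only [pathSym_C_mul, hzero, htop, mul_zero, Finset.sum_const_zero, zero_add,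
      Fin.val_last] at hsym
    have hm : (m : F) + 2 ≠ 0 := by exact_mod_cast (by omega : m + 2 ≠ 0)
    apply mul_left_cancel₀ hm
    rw [hsym, Nat.factorial_succ]
    push_cast
    ring

/-- The monomial `∏ y_i ^ c_i` in the partial sums `y_i`. -/
noncomputable def pathMonomial (F : Type*) [Field F] {n : ℕ} (c : Fin (n + 1) → ℕ) :
    MvPolynomial (Fin (n + 1)) F :=
  ∏ i, pathY n F i ^ c i

theorem pathMonomial_add_single {n : ℕ} (c : Fin (n + 1) → ℕ) (k : Fin (n + 1)) :
    pathMonomial F (c + Pi.single k 1) = pathY n F k * pathMonomial F c := by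
  simp only [pathMonomial, Pi.add_apply, pow_add, Finset.prod_mul_distrib]
  rw [mul_comm, Finset.prod_eq_single k (fun j _ hj => by simp [hj]) (by simp)]
  simp

theorem totalDegree_pathMonomial_le {n : ℕ} (c : Fin (n + 1) → ℕ) :
    (pathMonomial F c).totalDegree ≤ ∑ i, c i :=
  (totalDegree_finsetProd _ _).trans (Finset.sum_le_sum fun i _ =>
    (totalDegree_pow _ _).trans
      ((Nat.mul_le_mul_left _ (totalDegree_pathY_le i)).trans (by simp)))

theorem pathSym_pathMonomial_of_last_pos {n : ℕ} {x : Fin (n + 1) → F}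
    (hx : Function.Injective x) {c : Fin (n + 1) → ℕ} (hc : ∑ j, c j = n)
    (hpos : 0 < c (Fin.last n)) : pathSym x (pathMonomial F c) = 0 := by
  obtain ⟨d, rfl⟩ : ∃ d, c = d + Pi.single (Fin.last n) 1 :=
    ⟨c - Pi.single (Fin.last n) 1, by
      funext j
      by_cases hj : j = Fin.last n
      · subst hj; simp; omega
      · simp [hj]⟩
  rw [pathMonomial_add_single]
  refine pathSym_pathY_last_mul_eq_zero hx _ ((totalDegree_pathMonomial_le d).trans_lt ?_)
  simp [Finset.sum_add_distrib] at hc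
  omega

theorem pathSym_pathMonomial_balance [CharZero F] {n : ℕ} {x : Fin (n + 1) → F}
    (hx : Function.Injective x) (d : Fin (n + 1) → ℕ) (hd : ∑ j, d j + 2 = n)
    (k : Fin (n + 1)) :
    pathSym x (pathMonomial F (d + Pi.single k 1 + Pi.single k 1)) +
      pathSym x (pathMonomial F (d + Pi.single k 1 + Pi.single k 1)) =
    pathSym x (pathMonomial F (d + Pi.single k 1 + Pi.single (k - 1) 1)) +
      pathSym x (pathMonomial F (d + Pi.single k 1 + Pi.single (k + 1) 1)) := by
  induction k using Fin.lastCases with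
  | last =>
    have h0 : ∀ i, pathSym x (pathMonomial F (d + Pi.single (Fin.last n) 1 + Pi.single i 1)) = 0 :=
      fun i => pathSym_pathMonomial_of_last_pos hx
        (by simp [Finset.sum_add_distrib]; omega) (by simp)
    simp only [h0]
  | cast i =>
    set g : MvPolynomial (Fin (n + 1)) F := pathMonomial F d with hg
    have hdeg : g.totalDegree + 1 < n := by
      have : g.totalDegree ≤ _ := totalDegree_pathMonomial_le d
      omega
    have hA := pathSym_pathY_mul_sub_eq_zero hx i g hdeg
    have hdegB : (pathY n F i.castSucc * g).totalDegree < n := by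
      have h1 := totalDegree_mul (pathY n F i.castSucc) g
      have h2 := totalDegree_pathY_le (F := F) i.castSucc
      omega
    have hB := pathSym_pathY_last_mul_eq_zero hx _ hdegB
    simp only [pathMonomial_add_single, ← hg, Fin.coeSucc_eq_succ]
    obtain ⟨m, rfl⟩ : ∃ m, n = m + 1 := ⟨n - 1, by omega⟩
    have hs := pathY_succ (F := F) i
    induction i using Fin.cases with
    | zero =>
      have hp : (Fin.castSucc (0 : Fin (m + 1))) - 1 = Fin.last (m + 1) := by
        rw [Fin.castSucc_zero]
        exact sub_eq_of_eq_add (Fin.last_add_one _).symm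
      have key : pathY (m + 1) F (Fin.castSucc 0) * (pathY (m + 1) F (Fin.castSucc 0) * g) +
          pathY (m + 1) F (Fin.castSucc 0) * (pathY (m + 1) F (Fin.castSucc 0) * g) =
          pathY (m + 1) F (Fin.succ 0) * (pathY (m + 1) F (Fin.castSucc 0) * g) +
          pathY (m + 1) F (Fin.castSucc 0) * g * (X (Fin.castSucc 0) - X (Fin.succ 0)) := by
        rw [hs, Fin.castSucc_zero, pathY_zero]
        ring
      rw [hp, hB, zero_add, ← pathSym_add, key, pathSym_add, hA, add_zero]
    | succ j =>
      have hp : j.succ.castSucc - 1 = j.castSucc.castSucc := by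
        rw [← Fin.succ_castSucc, ← Fin.coeSucc_eq_succ, add_sub_cancel_right]
      have hs' := pathY_succ (F := F) j.castSucc
      rw [Fin.succ_castSucc] at hs'
      have key : pathY (m + 1) F j.succ.castSucc * (pathY (m + 1) F j.succ.castSucc * g) +
          pathY (m + 1) F j.succ.castSucc * (pathY (m + 1) F j.succ.castSucc * g) =
          pathY (m + 1) F j.castSucc.castSucc * (pathY (m + 1) F j.succ.castSucc * g) +
          pathY (m + 1) F j.succ.succ * (pathY (m + 1) F j.succ.castSucc * g) +
          pathY (m + 1) F j.succ.castSucc * g * (X j.succ.castSucc - X j.succ.succ) := by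
        rw [hs, hs']
        ring
      rw [hp, ← pathSym_add, key, pathSym_add, pathSym_add, hA, add_zero]

end

section

variable {n : ℕ}

theorem sandpile_nonpos (R : (Fin (n + 1) → ℕ) → ℝ)
    (hstable : R (fun j => if j = Fin.last n then 0 else 1) = 0)
    (hlast : ∀ c : Fin (n + 1) → ℕ, ∑ j, c j = n → 0 < c (Fin.last n) → R c = 0)
    (hbal : ∀ (d : Fin (n + 1) → ℕ), ∑ j, d j + 2 = n → ∀ k,
      R (d + Pi.single k 1 + Pi.single k 1) + R (d + Pi.single k 1 + Pi.single k 1) =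
        R (d + Pi.single k 1 + Pi.single (k - 1) 1) + R (d + Pi.single k 1 + Pi.single (k + 1) 1))
    (c : Fin (n + 1) → ℕ) (hc : ∑ j, c j = n) : R c ≤ 0 := by
  set S : Finset (Fin (n + 1) → ℕ) := Finset.piAntidiag Finset.univ n with hS
  have hmem : ∀ c : Fin (n + 1) → ℕ, c ∈ S ↔ ∑ j, c j = n := fun c => by simp [hS]
  set w : (Fin (n + 1) → ℕ) → ℕ := fun c => ∑ j : Fin (n + 1), (j : ℕ) * c j with hw
  have hw_add : ∀ (d : Fin (n + 1) → ℕ) (k : Fin (n + 1)),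
      w (d + Pi.single k 1) = w d + k := fun d k => by
    simp [hw, mul_add, Finset.sum_add_distrib, Pi.single_apply]
  have hsum_add : ∀ (d : Fin (n + 1) → ℕ) k,
      ∑ j, (d + Pi.single k 1 : Fin (n + 1) → ℕ) j = ∑ j, d j + 1 := fun d k => by
    simp [Finset.sum_add_distrib]
  obtain ⟨b, hbS, hmax⟩ := S.exists_max_image (fun c => toLex (R c, w c)) ⟨c, (hmem c).2 hc⟩
  have hle : ∀ a, ∑ j, a j = n → R a ≤ R b := fun a ha => by
    rcases (Prod.Lex.toLex_le_toLex.1 (hmax a ((hmem a).2 ha))) with h | h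
    · exact h.le
    · exact h.1.le
  have hwle : ∀ a, ∑ j, a j = n → R a = R b → w a ≤ w b := fun a ha hab => by
    rcases (Prod.Lex.toLex_le_toLex.1 (hmax a ((hmem a).2 ha))) with h | h
    · exact absurd hab h.ne
    · exact h.2
  have hb := (hmem b).1 hbS
  refine (hle c hc).trans (le_of_eq ?_)
  by_cases hpos : 0 < b (Fin.last n)
  · exact hlast b hb hpos
  by_cases hst : ∃ k, 2 ≤ b k
  · exfalso
    obtain ⟨k, hk⟩ := hst
    obtain ⟨d, rfl⟩ : ∃ d, b = d + Pi.single k 1 + Pi.single k 1 :=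
      ⟨b - Pi.single k 2, by
        funext j
        by_cases hj : j = k
        · subst hj; simp; omega
        · simp [hj]⟩
    have hd : ∑ j, d j + 2 = n := by rw [hsum_add, hsum_add] at hb; exact hb
    have h1 := hle (d + Pi.single k 1 + Pi.single (k - 1) 1) (by simp only [hsum_add]; omega)
    have h2 := hle (d + Pi.single k 1 + Pi.single (k + 1) 1) (by simp only [hsum_add]; omega)
    have h3 := hwle (d + Pi.single k 1 + Pi.single (k + 1) 1) (by simp only [hsum_add]; omega)
      (by linarith [hbal d hd k])
    have hkl : k ≠ Fin.last n := by
      rintro rfl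
      omega
    rw [hw_add, hw_add, hw_add, hw_add, Fin.val_add_one_of_lt (Fin.lt_last_iff_ne_last.2 hkl)] at h3
    omega
  · push Not at hst
    have hle1 : ∀ j ∈ Finset.univ, b j ≤ if j = Fin.last n then 0 else 1 := fun j _ => by
      split_ifs with h
      · subst h; omega
      · have := hst j; omega
    have hsum : ∑ j, b j = ∑ j : Fin (n + 1), if j = Fin.last n then 0 else 1 := by
      rw [hb, Fin.sum_univ_castSucc]
      simp [(Fin.castSucc_lt_last _).ne]
    have hbeq : b = fun j => if j = Fin.last n then 0 else 1 :=
      funext fun j => (Finset.sum_eq_sum_iff_of_le hle1).1 hsum j (Finset.mem_univ j)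
    rw [hbeq, hstable]

theorem sandpile_eq_zero {V : Type*} [AddCommGroup V] [Module ℝ V] (R : (Fin (n + 1) → ℕ) → V)
    (hstable : R (fun j => if j = Fin.last n then 0 else 1) = 0)
    (hlast : ∀ c : Fin (n + 1) → ℕ, ∑ j, c j = n → 0 < c (Fin.last n) → R c = 0)
    (hbal : ∀ (d : Fin (n + 1) → ℕ), ∑ j, d j + 2 = n → ∀ k,
      R (d + Pi.single k 1 + Pi.single k 1) + R (d + Pi.single k 1 + Pi.single k 1) =
        R (d + Pi.single k 1 + Pi.single (k - 1) 1) + R (d + Pi.single k 1 + Pi.single (k + 1) 1))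
    (c : Fin (n + 1) → ℕ) (hc : ∑ j, c j = n) : R c = 0 := by
  rw [← Module.forall_dual_apply_eq_zero_iff ℝ]
  have h : ∀ f : Module.Dual ℝ V, f (R c) ≤ 0 := fun f =>
    sandpile_nonpos (fun c => f (R c)) (by simp [hstable])
      (fun c hc hp => by simp [hlast c hc hp])
      (fun d hd k => by simp only [← map_add, hbal d hd k]) c hc
  intro f
  have h' := h (-f)
  rw [LinearMap.neg_apply] at h'
  exact le_antisymm (h f) (by linarith)

theorem sandpile_balance {P : (Fin (n + 1) → ℕ) → ℝ}
    (h : ∀ c : Fin (n + 1) → ℕ, (∑ j, c j) = n → ∀ k : Fin (n + 1), 2 ≤ c k →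
      2 * P c =
        P (fun j => if j = k then c k - 1 else if j = k - 1 then c j + 1 else c j) +
        P (fun j => if j = k then c k - 1 else if j = k + 1 then c j + 1 else c j))
    (d : Fin (n + 1) → ℕ) (hd : ∑ j, d j + 2 = n) (k : Fin (n + 1)) :
    P (d + Pi.single k 1 + Pi.single k 1) + P (d + Pi.single k 1 + Pi.single k 1) =
      P (d + Pi.single k 1 + Pi.single (k - 1) 1) +
        P (d + Pi.single k 1 + Pi.single (k + 1) 1) := by
  obtain ⟨m, rfl⟩ : ∃ m, n = m + 1 := ⟨n - 1, by omega⟩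
  have hmove : ∀ i : Fin (m + 1 + 1), k ≠ i →
      (fun j => if j = k then (d + Pi.single k 1 + Pi.single k 1 : Fin (m + 1 + 1) → ℕ) k - 1
        else if j = i then (d + Pi.single k 1 + Pi.single k 1 : Fin (m + 1 + 1) → ℕ) j + 1
        else (d + Pi.single k 1 + Pi.single k 1 : Fin (m + 1 + 1) → ℕ) j) =
      d + Pi.single k 1 + Pi.single i 1 := by
    intro i hi
    funext j
    by_cases hj : j = k
    · subst hj
      simp [hi]
    · by_cases hji : j = i
      · subst hji
        simp [hj]
      · simp [hj, hji]
  have h' := h (d + Pi.single k 1 + Pi.single k 1)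
    (by simp [Finset.sum_add_distrib]; omega) k (by simp)
  rw [hmove (k - 1) fun h => one_ne_zero (sub_eq_self.1 h.symm), hmove (k + 1) (by simp)] at h'
  linarith

theorem DS_pathEdges_eq_pathSym (c : Fin (n + 1) → ℕ) :
    DS (pathEdges n) (∏ i : Fin (n + 1), pathY n ℝ i ^ c i) =
      pathSym (fun i => algebraMap (MvPolynomial (Fin (n + 1)) ℝ)
        (FractionRing (MvPolynomial (Fin (n + 1)) ℝ)) (X i)) (pathMonomial _ c) := by
  refine Finset.sum_congr rfl fun π _ => ?_
  have hinj : Function.Injective fun i : Fin n => (i.castSucc, i.succ) := fun i j h =>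
    Fin.castSucc_injective _ (Prod.ext_iff.1 h).1
  rw [pathEdges, Finset.prod_image hinj.injOn]
  simp [pathMonomial, pathY, pathDiff, map_prod]

end

/-- Theorem 3, sandpile interpretation: for the path `G` on
`x_0, …, x_n`, `Φ = DS_G` (over `ℝ`), and `y_i = x_0 + ⋯ + x_i`: if a real-valued
function `P` on the `(n+1)`-tuples `(c_0, …, c_n)` of nonnegative integers with
`Σ c_i = n` (indices modulo `n + 1`) satisfies (i) `P(1, 1, …, 1, 0) = 1`;
(ii) `P(c) = 0` whenever `c_n > 0`; and (iii) `2·P(c) = P(c_{k−1} += 1, c_k −= 1) +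
P(c_k −= 1, c_{k+1} += 1)` whenever `c_k ≥ 2`, then
`P(c_0, …, c_n) = Φ(Π_{i=0}^{n} y_i^{c_i}) / n!` for every such tuple. -/
theorem sandpile_probability_eq_divided_symmetrization (n : ℕ)
    (P : (Fin (n + 1) → ℕ) → ℝ)
    (h1 : P (fun j => if j = Fin.last n then 0 else 1) = 1)
    (h2 : ∀ c : Fin (n + 1) → ℕ, (∑ j, c j) = n → 0 < c (Fin.last n) → P c = 0)
    (h3 : ∀ c : Fin (n + 1) → ℕ, (∑ j, c j) = n → ∀ k : Fin (n + 1), 2 ≤ c k →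
      2 * P c =
        P (fun j => if j = k then c k - 1 else if j = k - 1 then c j + 1 else c j) +
        P (fun j => if j = k then c k - 1 else if j = k + 1 then c j + 1 else c j)) :
    ∀ c : Fin (n + 1) → ℕ, (∑ j, c j) = n →
      algebraMap (MvPolynomial (Fin (n + 1)) ℝ)
          (FractionRing (MvPolynomial (Fin (n + 1)) ℝ)) (C (P c)) =
        DS (pathEdges n) (∏ i : Fin (n + 1), pathY n ℝ i ^ c i) /
          (n.factorial : FractionRing (MvPolynomial (Fin (n + 1)) ℝ)) := by
  set A := MvPolynomial (Fin (n + 1)) ℝ with hA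
  set F := FractionRing A with hF
  set x : Fin (n + 1) → F := fun i => algebraMap A F (X i) with hx
  have hxinj : Function.Injective x :=
    (IsFractionRing.injective A F).comp (X_injective (R := ℝ))
  have : CharZero F := algebraRat.charZero F
  have hfac : (n.factorial : F) ≠ 0 := Nat.cast_ne_zero.2 n.factorial_ne_zero
  intro c hc
  rw [DS_pathEdges_eq_pathSym, ← sub_eq_zero]
  refine sandpile_eq_zero
    (fun c => algebraMap A F (C (P c)) - pathSym x (pathMonomial F c) / (n.factorial : F))
    ?_ ?_ ?_ c hc
  · have h : pathMonomial F (fun j => if j = Fin.last n then 0 else 1) =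
        ∏ k : Fin n, pathY n F k.castSucc := by
      rw [pathMonomial, Fin.prod_univ_castSucc]
      simp [(Fin.castSucc_lt_last _).ne]
    simp only [h, h1, pathSym_prod_pathY hxinj, div_self hfac, map_one, sub_self]
  · intro c hc hpos
    simp only [h2 c hc hpos, pathSym_pathMonomial_of_last_pos hxinj hc hpos, map_zero, zero_div,
      sub_self]
  · intro d hd k
    have hP := congrArg (fun r => algebraMap A F (C r)) (sandpile_balance h3 d hd k)
    have hQ := pathSym_pathMonomial_balance hxinj d hd k
    simp only [map_add] at hP
    linear_combination hP - hQ / (n.factorial : F)
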